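/- Assume gcd(s+l,2l) = gcd(s,l) = d and d is odd. Then the number of quadruples (a,b,c,h) ∈ F_{p^s} × F_q × F_q × F_p for which the codeword c(a,b,c,h) has Hamming weight p^{m−1}(p−1) equals p·(p^{3s−d} − p^{3s−2d} + p^{3s−2d−1} + p^{3s−3d} − p^{m−2d} + 1)(p^m − 1). -/

import Mathlib

/-- `trp p r z = z + z^p + ⋯ + z^(p^(r-1))`, the trace form used for `Tr_r`. -/
def trp (p r : ℕ) {F : Type} [Field F] (z : F) : F :=
  ∑ i ∈ Finset.range r, z ^ p ^ i

/-- The codeword `c(a,b,c,h)` of the code `C`, viewed as a function on `F_q = F`;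
its value at `x` is `Tr_s(a x^(p^s+1)) + Tr_m(b x^(p^l+1) + c x) + h` (the values
lie in the prime field `F_p ⊆ F`). Here `m = 2s`. -/
def cword (p s l : ℕ) {F : Type} [Field F] (a b c : F) (h : ZMod p) : F → F :=
  fun x => trp p s (a * x ^ (p ^ s + 1)) + trp p (2 * s) (b * x ^ (p ^ l + 1) + c * x)
    + ZMod.cast h

/-- The support of the codeword `c(a,b,c,h)`; its cardinality is the Hamming weight. -/
def suppw (p s l : ℕ) {F : Type} [Field F] [Fintype F] [DecidableEq F]
    (a b c : F) (h : ZMod p) : Finset F :=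
  Finset.univ.filter fun x => cword p s l a b c h x ≠ 0

section Counting

open Finset

/-- If `f` increases by `t` under translation by `t • w`, all its fibres have the same size. -/
theorem card_fiber_mul_of_translate {p : ℕ} [NeZero p] {V : Type*} [AddCommGroup V] [Module (ZMod p) V]
    [Fintype V] (f : V → ZMod p) (w : V) (hf : ∀ x t, f (x + t • w) = f x + t) (h : ZMod p) :
    p * #{x | f x = h} = Fintype.card V := by
  have key : ∀ k : ZMod p, #{x | f x = k} = #{x | f x = h} := by
    intro k
    refine Finset.card_bij' (fun x _ => x + (h - k) • w) (fun x _ => x + (k - h) • w) ?_ ?_ ?_ ?_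
    · intro x hx; simp only [mem_filter, mem_univ, true_and] at hx ⊢; rw [hf, hx]; ring
    · intro x hx; simp only [mem_filter, mem_univ, true_and] at hx ⊢; rw [hf, hx]; ring
    · intro x _; rw [add_assoc, ← add_smul]; simp
    · intro x _; rw [add_assoc, ← add_smul]; simp
  have := Finset.card_eq_sum_card_fiberwise (f := f) (s := univ) (t := univ) (by simp)
  rw [← Finset.card_univ, this, Finset.sum_congr rfl (fun k _ => key k)]
  simp [ZMod.card]

/-- In `p β² + γ² = p ^ j`, one of the two squares vanishes, according to the parity of `j`. -/
theorem mul_sq_add_sq_eq_prime_pow {p : ℕ} (hp : p.Prime) (hp2 : 2 < p) (j : ℕ) (β γ : ℤ)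
    (h : (p : ℤ) * β ^ 2 + γ ^ 2 = p ^ j) :
    (Even j → β = 0 ∧ γ ≠ 0) ∧ (¬ Even j → γ = 0 ∧ β ≠ 0) := by
  induction j generalizing β γ with
  | zero =>
    have hβ : β = 0 := by
      by_contra hb
      have : 1 ≤ β ^ 2 := by have := sq_pos_of_ne_zero hb; omega
      have hp' : (2 : ℤ) < p := by exact_mod_cast hp2
      nlinarith [sq_nonneg γ]
    refine ⟨fun _ => ⟨hβ, ?_⟩, fun h => absurd Even.zero h⟩
    rintro rfl
    simp [hβ] at h
  | succ j ih =>
    have hp' : Prime (p : ℤ) := Nat.prime_iff_prime_int.mp hp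
    have hd : (p : ℤ) ∣ γ := by
      apply hp'.dvd_of_dvd_pow (n := 2)
      have : γ ^ 2 = p * (p ^ j - β ^ 2) := by rw [mul_sub, ← pow_succ', ← h]; ring
      exact ⟨_, this⟩
    obtain ⟨δ, rfl⟩ := hd
    have h2 : (p : ℤ) * δ ^ 2 + β ^ 2 = p ^ j := by
      apply mul_left_cancel₀ hp'.ne_zero
      rw [← pow_succ', ← h]; ring
    have := ih δ β h2
    have hp0 := hp'.ne_zero
    rw [Nat.even_add_one]
    refine ⟨fun hj => ⟨(this.2 hj).1, mul_ne_zero hp0 (this.2 hj).2⟩, fun hj => ?_⟩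
    have := this.1 (not_not.mp hj)
    exact ⟨by rw [this.1, mul_zero], this.2⟩

variable {p : ℕ} [Fact p.Prime] {V : Type*} [AddCommGroup V] [Module (ZMod p) V]

theorem card_dual_fiber_mul [Fintype V] (L : V →ₗ[ZMod p] ZMod p) (hL : L ≠ 0) (h : ZMod p) :
    p * #{x | L x = h} = Fintype.card V := by
  obtain ⟨w, hw⟩ : ∃ w, L w ≠ 0 := by
    by_contra! H
    exact hL (LinearMap.ext H)
  refine card_fiber_mul_of_translate _ ((L w)⁻¹ • w) (fun x t => ?_) h
  simp [hw]

variable (B : V →ₗ[ZMod p] V →ₗ[ZMod p] ZMod p)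

/-- The quadratic form `x ↦ B x x` on a finite space of odd characteristic: second moment of its
fibre sizes. -/
theorem sum_sq_card_quadratic_fiber [Fintype V] (hp : p ≠ 2) :
    p * ∑ h, #{x | B x x = h} ^ 2 + Fintype.card V * Nat.card (LinearMap.ker (B + B.flip))
      = p * Fintype.card V * Nat.card (LinearMap.ker (B + B.flip)) + Fintype.card V ^ 2 := by
  classical
  set S := B + B.flip with hS
  have two : (2 : ZMod p) ≠ 0 := by
    have : Fact (2 < p) := ⟨lt_of_le_of_ne (Fact.out : p.Prime).two_le hp.symm⟩
    exact ZMod.neg_one_ne_one.symm ∘ fun h => by linear_combination h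
  have hinv : ∀ x : V, (2⁻¹ : ZMod p) • (x + x) = x := by
    intro x; rw [← two_smul (ZMod p) x, smul_smul, inv_mul_cancel₀ two, one_smul]
  have e1 : ∑ h, #{x | B x x = h} ^ 2 = #{z : V × V | B z.1 z.1 = B z.2 z.2} := by
    rw [Finset.card_eq_sum_card_fiberwise (f := fun z => B z.1 z.1) (t := univ) (by simp)]
    refine Finset.sum_congr rfl fun h _ => ?_
    rw [sq, ← Finset.card_product]
    congr 1
    ext z
    simp only [mem_product, mem_filter, mem_univ, true_and]
    constructor
    · rintro ⟨h1, h2⟩; exact ⟨h1.trans h2.symm, h1⟩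
    · rintro ⟨h1, h2⟩; exact ⟨h2, h1 ▸ h2⟩
  have e2 : #{z : V × V | B z.1 z.1 = B z.2 z.2} = #{z : V × V | S z.1 z.2 = 0} := by
    refine Finset.card_bij' (fun z _ => (z.1 - z.2, z.1 + z.2))
      (fun z _ => ((2⁻¹ : ZMod p) • (z.1 + z.2), (2⁻¹ : ZMod p) • (z.2 - z.1))) ?_ ?_ ?_ ?_
    · rintro ⟨x, y⟩ h
      simp only [mem_filter, mem_univ, true_and] at h
      simp [hS]
      linear_combination 2 * h
    · rintro ⟨x, y⟩ h
      simp [hS] at h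
      simp
      linear_combination 2 * (2⁻¹ : ZMod p) ^ 2 * h
    · rintro ⟨x, y⟩ _
      ext
      · dsimp only; rw [sub_add_add_cancel, hinv]
      · dsimp only; rw [add_sub_sub_cancel, hinv]
    · rintro ⟨x, y⟩ _
      ext
      · dsimp only; rw [← smul_sub, show x + y - (y - x) = x + x by abel, hinv]
      · dsimp only; rw [← smul_add, show x + y + (y - x) = y + y by abel, hinv]
  have e3 : #{z : V × V | S z.1 z.2 = 0} = ∑ u, #{v | S u v = 0} := by
    rw [Finset.card_eq_sum_card_fiberwise (f := fun z => z.1) (t := univ) (by simp)]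
    refine Finset.sum_congr rfl fun u _ => ?_
    refine Finset.card_bij' (fun z _ => z.2) (fun v _ => (u, v)) ?_ ?_ ?_ ?_
    · rintro ⟨x, y⟩ h; simp at h ⊢; rw [← h.2]; exact h.1
    · intro v h; simpa using h
    · rintro ⟨x, y⟩ h; simp at h ⊢; exact h.2.symm
    · intro v h; rfl
  have e4 : p * ∑ u, #{v | S u v = 0}
      = ∑ u, if S u = 0 then p * Fintype.card V else Fintype.card V := by
    rw [Finset.mul_sum]
    refine Finset.sum_congr rfl fun u _ => ?_
    split_ifs with hu
    · simp [hu]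
    · exact card_dual_fiber_mul (S u) hu 0
  have e5 : Nat.card (LinearMap.ker S) = #{u | S u = 0} := by
    rw [Nat.card_eq_fintype_card]
    exact Fintype.card_of_subtype _ (by simp)
  rw [e1, e2, e3, e4, Finset.sum_ite, Finset.sum_const, Finset.sum_const, e5]
  have e6 : #{u | S u = 0} + #{u | ¬ S u = 0} = Fintype.card V :=
    Finset.card_filter_add_card_filter_not _
  simp only [smul_eq_mul]
  rw [← e6]
  ring

theorem even_card_quadratic_fiber [Fintype V] (hp : p ≠ 2) (h : ZMod p) (hh : h ≠ 0) :
    Even #{x | B x x = h} := by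
  have two : (2 : ZMod p) ≠ 0 := by
    have : Fact (2 < p) := ⟨lt_of_le_of_ne (Fact.out : p.Prime).two_le hp.symm⟩
    exact ZMod.neg_one_ne_one.symm ∘ fun h => by linear_combination h
  rw [← ZMod.natCast_eq_zero_iff_even, Finset.card_eq_sum_ones, Nat.cast_sum]
  refine Finset.sum_involution (fun x _ => -x) ?_ ?_ ?_ ?_
  · intro x _; decide
  · intro x hx _ hn
    simp only [mem_filter, mem_univ, true_and] at hx
    have : x = 0 := by
      have h2 : (2 : ZMod p) • x = 0 := by rw [two_smul]; nth_rewrite 1 [← hn]; simp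
      exact (smul_eq_zero.mp h2).resolve_left two
    exact hh (by simpa [this] using hx.symm)
  · intro x hx; simpa using hx
  · intro x _; simp

theorem card_quadratic_fiber_sq_mul [Fintype V] (t h : ZMod p) (ht : t ≠ 0) :
    #{x | B x x = t ^ 2 * h} = #{x | B x x = h} := by
  refine Finset.card_bij' (fun x _ => t⁻¹ • x) (fun x _ => t • x) ?_ ?_ ?_ ?_
  · intro x hx; simp at hx ⊢; rw [hx]; field_simp
  · intro x hx; simp at hx ⊢; rw [hx]; ring
  · intro x _; simp [smul_smul, ht]
  · intro x _; simp [smul_smul, ht]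

/-- A function on `ZMod p` invariant under multiplication by nonzero squares is a combination of
`1` and the quadratic character away from zero. -/
theorem sum_of_sq_invariant (hp : p ≠ 2) (f : ZMod p → ℤ)
    (hf : ∀ t h, t ≠ 0 → f (t ^ 2 * h) = f h) :
    ∃ g : ZMod p, g ≠ 0 ∧ (∀ h, h ≠ 0 → f h = f 1 ∨ f h = f g) ∧
      2 * ∑ h, f h = 2 * f 0 + (p - 1) * (f 1 + f g) ∧
      2 * ∑ h, f h ^ 2 = 2 * f 0 ^ 2 + (p - 1) * (f 1 ^ 2 + f g ^ 2) := by
  have hr : ringChar (ZMod p) ≠ 2 := by rwa [ZMod.ringChar_zmod_n]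
  obtain ⟨g, hg⟩ := FiniteField.exists_nonsquare hr
  have g0 : g ≠ 0 := by rintro rfl; exact hg (IsSquare.zero)
  have hsq : ∀ h, h ≠ 0 → IsSquare h → f h = f 1 := by
    rintro h h0 ⟨t, rfl⟩
    have : t ≠ 0 := by rintro rfl; simp at h0
    rw [← hf t 1 this]; congr 1; ring
  have hns : ∀ h, h ≠ 0 → ¬ IsSquare h → f h = f g := by
    intro h h0 hs
    have h1 : quadraticChar (ZMod p) (h * g) = 1 := by
      rw [map_mul, quadraticChar_neg_one_iff_not_isSquare.mpr hs,
        quadraticChar_neg_one_iff_not_isSquare.mpr hg]; rfl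
    obtain ⟨t, ht⟩ := (quadraticChar_one_iff_isSquare (mul_ne_zero h0 g0)).mp h1
    have t0 : t ≠ 0 := by rintro rfl; simp [h0, g0] at ht
    have : h = (t / g) ^ 2 * g := by field_simp; linear_combination ht
    rw [this, hf _ _ (div_ne_zero t0 g0)]
  have key : ∀ F : ℤ → ℤ, 2 * ∑ h, F (f h) = 2 * F (f 0) + (p - 1) * (F (f 1) + F (f g)) := by
    intro F
    have hpt : ∀ h, 2 * F (f h) = (F (f 1) + F (f g)) + quadraticChar (ZMod p) h * (F (f 1) - F (f g))
        + if h = 0 then (2 * F (f 0) - (F (f 1) + F (f g))) else 0 := by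
      intro h
      split_ifs with h0
      · simp [h0]
      · by_cases hs : IsSquare h
        · rw [(quadraticChar_one_iff_isSquare h0).mpr hs, hsq h h0 hs]; ring
        · rw [quadraticChar_neg_one_iff_not_isSquare.mpr hs, hns h h0 hs]; ring
    rw [Finset.mul_sum, Finset.sum_congr rfl fun h _ => hpt h, Finset.sum_add_distrib,
      Finset.sum_add_distrib, ← Finset.sum_mul, quadraticChar_sum_zero hr]
    simp [ZMod.card]
    ring
  refine ⟨g, g0, fun h h0 => ?_, key id, key (· ^ 2)⟩
  by_cases hs : IsSquare h
  · exact Or.inl (hsq h h0 hs)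
  · exact Or.inr (hns h h0 hs)

theorem card_quadratic_fiber_eq_iff [Fintype V] (hp : p ≠ 2) {m k : ℕ} (hm : 1 ≤ m)
    (hV : Fintype.card V = p ^ m) (hW : Nat.card (LinearMap.ker (B + B.flip)) = p ^ k)
    (h : ZMod p) : #{x | B x x = h} = p ^ (m - 1) ↔ ¬ Even (m + k) ∧ h = 0 := by
  have pp : p.Prime := Fact.out
  have hp2 : 2 < p := lt_of_le_of_ne pp.two_le hp.symm
  have podd : Odd (p : ℤ) := by exact_mod_cast pp.odd_of_ne_two hp
  obtain ⟨M, rfl⟩ : ∃ M, m = M + 1 := ⟨m - 1, by omega⟩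
  simp only [Nat.add_sub_cancel]
  have e : ∀ k : ZMod p, #{x | B x x = k} = p ^ M ↔
      (#{x | B x x = k} : ℤ) - p ^ M = 0 := by
    intro k; rw [sub_eq_zero]; norm_cast
  rw [e]
  set f : ZMod p → ℤ := fun h => (#{x | B x x = h} : ℤ) - p ^ M with hf
  obtain ⟨g, g0, hcase, hs1, hs2⟩ := sum_of_sq_invariant hp f (by
    intro t h ht; simp only [hf]; rw [card_quadratic_fiber_sq_mul B t h ht])
  have sumn : ∑ h : ZMod p, (#{x | B x x = h} : ℤ) = p ^ (M + 1) := by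
    have := Finset.card_eq_sum_card_fiberwise (f := fun x => B x x) (s := univ) (t := univ) (by simp)
    rw [Finset.card_univ, hV] at this
    exact_mod_cast this.symm
  have sumf : ∑ h, f h = 0 := by
    simp only [hf, Finset.sum_sub_distrib, sumn]
    simp [ZMod.card, pow_succ']
  have sumf2 : ∑ h, f h ^ 2 = (p : ℤ) ^ (M + k) * (p - 1) := by
    have h2 := sum_sq_card_quadratic_fiber B hp
    rw [hV, hW] at h2
    have h3 : (p : ℤ) * ∑ h : ZMod p, (#{x | B x x = h} : ℤ) ^ 2 + p ^ (M + 1) * p ^ k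
      = p * p ^ (M + 1) * p ^ k + (p ^ (M + 1)) ^ 2 := by exact_mod_cast h2
    have p0 : (p : ℤ) ≠ 0 := by exact_mod_cast pp.ne_zero
    apply mul_left_cancel₀ p0
    have : ∑ h, f h ^ 2 = ∑ h : ZMod p, (#{x | B x x = h} : ℤ) ^ 2
        - 2 * p ^ M * ∑ h : ZMod p, (#{x | B x x = h} : ℤ) + p * (p ^ M) ^ 2 := by
      simp only [hf, sub_sq, Finset.sum_add_distrib, Finset.sum_sub_distrib, ← Finset.sum_mul,
        ← Finset.mul_sum]
      simp [ZMod.card]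
      ring
    rw [this, sumn]
    linear_combination h3
  have podd' : ∀ n, Odd ((p : ℤ) ^ n) := fun n => podd.pow
  have hfodd : ∀ h, h ≠ 0 → Odd (f h) := by
    intro h hh
    have := even_card_quadratic_fiber B hp h hh
    exact Even.sub_odd (by exact_mod_cast this) (podd' M)
  obtain ⟨β, hβ⟩ := (hfodd 1 one_ne_zero).add_odd (hfodd g g0)
  obtain ⟨γ, hγ⟩ := (hfodd 1 one_ne_zero).sub_odd (hfodd g g0)
  have f1 : f 1 = β + γ := by omega
  have fg : f g = β - γ := by omega
  have hp1 : (p : ℤ) - 1 ≠ 0 := by have : (2 : ℤ) < p := by exact_mod_cast hp2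
                                   omega
  rw [sumf, f1, fg] at hs1
  rw [sumf2, f1, fg] at hs2
  have f0 : f 0 = -((p - 1) * β) := by
    have : 2 * (f 0 + (p - 1) * β) = 0 := by linear_combination -hs1
    linarith
  have main : (p : ℤ) * β ^ 2 + γ ^ 2 = p ^ (M + k) := by
    apply mul_left_cancel₀ hp1
    rw [f0] at hs2
    linarith
  have := mul_sq_add_sq_eq_prime_pow pp hp2 _ _ _ main
  change f h = 0 ↔ _
  rw [show M + 1 + k = M + k + 1 by ring, Nat.even_add_one, not_not]
  by_cases hj : Even (M + k)
  · obtain ⟨rfl, h2⟩ := this.1 hj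
    simp only [hj, true_and]
    constructor
    · intro h3; by_contra h4
      rcases hcase h h4 with h5 | h5 <;> rw [h5] at h3
      · apply h2; simpa [f1] using h3
      · apply h2; simpa [fg] using h3
    · rintro rfl; simp [f0]
  · obtain ⟨rfl, h2⟩ := this.2 hj
    simp only [hj, false_and, iff_false]
    intro h3
    rcases eq_or_ne h 0 with rfl | h4
    · simp [f0, hp1, h2] at h3
    · rcases hcase h h4 with h5 | h5 <;> rw [h5] at h3
      · apply h2; simpa [f1] using h3
      · apply h2; simpa [fg] using h3

theorem mem_range_add_flip_iff [Module.Finite (ZMod p) V] (L : Module.Dual (ZMod p) V) :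
    L ∈ LinearMap.range (B + B.flip) ↔ ∀ w ∈ LinearMap.ker (B + B.flip), L w = 0 := by
  set S := B + B.flip with hS
  have hr : LinearMap.range S = (LinearMap.ker S).dualAnnihilator := by
    rw [← LinearMap.range_dualMap_eq_dualAnnihilator_ker]
    ext L
    simp only [LinearMap.mem_range]
    constructor
    · rintro ⟨x, rfl⟩
      refine ⟨Module.Dual.eval _ _ x, ?_⟩
      ext y; simp [hS, add_comm]
    · rintro ⟨φ, rfl⟩
      obtain ⟨x, rfl⟩ := (Module.evalEquiv (ZMod p) V).surjective φ
      refine ⟨x, ?_⟩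
      ext y; simp [hS, add_comm]
  rw [hr, Submodule.mem_dualAnnihilator]

/-- The number of affine perturbations `L + h` of the quadratic form `x ↦ B x x` for which the
zero set has the generic size `p ^ (m - 1)`. -/
theorem card_perturbation [Fintype V] (hp : p ≠ 2) {m k : ℕ} (hm : 1 ≤ m)
    (hV : Fintype.card V = p ^ m) (hW : Nat.card (LinearMap.ker (B + B.flip)) = p ^ k) :
    (Nat.card {t : Module.Dual (ZMod p) V × ZMod p // 
        #{x | B x x + t.1 x + t.2 = 0} = p ^ (m - 1)} : ℤ)
      = p * (p ^ m - p ^ (m - k)) + if Even (m + k) then 0 else p ^ (m - k) := by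
  classical
  have pp : p.Prime := Fact.out
  have two : (2 : ZMod p) ≠ 0 := by
    have : Fact (2 < p) := ⟨lt_of_le_of_ne pp.two_le hp.symm⟩
    exact ZMod.neg_one_ne_one.symm ∘ fun h => by linear_combination h
  set S := B + B.flip with hS
  have : Module.Finite (ZMod p) V := Module.Finite.of_finite
  have : Finite (Module.Dual (ZMod p) V) := Module.finite_of_finite (ZMod p)
  have : Fintype (Module.Dual (ZMod p) V) := Fintype.ofFinite _
  have hfr : Module.finrank (ZMod p) V = m := by
    have := Module.card_eq_pow_finrank (K := ZMod p) (V := V)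
    rw [hV, ZMod.card] at this
    exact (Nat.pow_right_injective pp.two_le this).symm
  have hk : Module.finrank (ZMod p) (LinearMap.ker S) = k := by
    have := Module.natCard_eq_pow_finrank (K := ZMod p) (V := LinearMap.ker S)
    rw [hW, Nat.card_zmod] at this
    exact (Nat.pow_right_injective pp.two_le this).symm
  have hrk : Module.finrank (ZMod p) (LinearMap.range S) = m - k := by
    have := LinearMap.finrank_range_add_finrank_ker S
    omega
  have hkm : k ≤ m := by
    rw [← hk, ← hfr]; exact Submodule.finrank_le _
  have cD : Fintype.card (Module.Dual (ZMod p) V) = p ^ m := by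
    rw [Module.card_eq_pow_finrank (K := ZMod p), Subspace.dual_finrank_eq, hfr, ZMod.card]
  have cR : #{L : Module.Dual (ZMod p) V | L ∈ LinearMap.range S} = p ^ (m - k) := by
    have := Module.natCard_eq_pow_finrank (K := ZMod p) (V := LinearMap.range S)
    rw [Nat.card_zmod, hrk, Nat.card_eq_fintype_card] at this
    rw [← this]
    exact (Fintype.card_of_subtype _ (by simp)).symm
  have hsum : Nat.card {t : Module.Dual (ZMod p) V × ZMod p // 
        #{x | B x x + t.1 x + t.2 = 0} = p ^ (m - 1)} = ∑ L : Module.Dual (ZMod p) V,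
        #{h | #{x | B x x + L x + h = 0} = p ^ (m - 1)} := by
    rw [Nat.card_eq_fintype_card, Fintype.card_subtype, Finset.card_filter, Fintype.sum_prod_type]
    simp only [Finset.card_filter]
  have hL : ∀ L : Module.Dual (ZMod p) V, #{h | #{x | B x x + L x + h = 0} = p ^ (m - 1)}
      = if L ∈ LinearMap.range S then (if Even (m + k) then 0 else 1) else p := by
    intro L
    split_ifs with h1 h2
    all_goals try
      obtain ⟨x0, rfl⟩ := h1
      have hcard : ∀ h, #{x | B x x + S x0 x + h = 0} = #{x | B x x = B x0 x0 - h} := by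
        intro h
        refine Finset.card_bij' (fun x _ => x + x0) (fun x _ => x - x0) ?_ ?_ ?_ ?_
        · intro x hx; simp [hS] at hx ⊢; linear_combination hx
        · intro x hx; simp [hS] at hx ⊢; linear_combination hx
        · intro x _; simp
        · intro x _; simp
      simp only [hcard, card_quadratic_fiber_eq_iff B hp hm hV hW]
    · simp [h2]
    · rw [Finset.card_eq_one]
      refine ⟨B x0 x0, ?_⟩
      ext h
      simp [h2, sub_eq_zero, eq_comm (a := h)]
    · rw [mem_range_add_flip_iff] at h1
      push Not at h1
      obtain ⟨w, hw, hLw⟩ := h1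
      have hw' : ∀ y, B w y + B y w = 0 := by
        intro y
        have := LinearMap.congr_fun (LinearMap.mem_ker.mp hw) y
        simpa [hS] using this
      have hQw : B w w = 0 := by
        have := hw' w
        rw [← two_mul] at this
        exact (mul_eq_zero.mp this).resolve_left two
      have hall : ∀ h, #{x | B x x + L x + h = 0} = p ^ (m - 1) := by
        intro h
        have := card_fiber_mul_of_translate (fun x => B x x + L x + h) ((L w)⁻¹ • w) (by
          intro x t
          simp [hLw, hQw]
          linear_combination t * (L w)⁻¹ * hw' x) 0
        rw [hV] at this
        apply Nat.eq_of_mul_eq_mul_left pp.pos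
        rw [this, ← pow_succ']; congr 1; omega
      simp [hall, ZMod.card]
  rw [hsum, Finset.sum_congr rfl fun L _ => hL L, Finset.sum_ite, Finset.sum_const,
    Finset.sum_const, cR]
  have hc : #{L : Module.Dual (ZMod p) V | L ∈ LinearMap.range S}
      + #{L : Module.Dual (ZMod p) V | ¬ L ∈ LinearMap.range S} = p ^ m := by
    rw [Finset.card_filter_add_card_filter_not, Finset.card_univ, cD]
  rw [cR] at hc
  have hc' : (p : ℤ) ^ (m - k) + #{L : Module.Dual (ZMod p) V | ¬ L ∈ LinearMap.range S} = p ^ m := by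
    exact_mod_cast hc
  rw [← hc']
  split_ifs <;> simp <;> ring

end Counting

section Radical

open Finset

/-- The linearized polynomial whose kernel is the radical of the quadratic form attached to
`(a, b)`; `σ`, `τ`, `J` are powers of Frobenius. -/
def radMap {F : Type*} [Field F] (σ τ J : F →+* F) (a b x : F) : F :=
  a * J x + b * σ x + τ (b * x)

/-- Two commuting field endomorphisms with `J` an involution and `τ` inverse to `σ`, such that
`σ² ` and `σ J` have no common fixed points outside the fixed field of `J`. -/
structure FrobPair {F : Type*} [Field F] (σ τ J : F →+* F) : Prop where
  J_J : ∀ x, J (J x) = x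
  σ_τ : ∀ x, σ (τ x) = x
  σ_J : ∀ x, σ (J x) = J (σ x)
  fix : ∀ x, σ (σ x) = x → σ (J x) = x → J x = x
  two_ne_zero : (2 : F) ≠ 0

namespace FrobPair

variable {F : Type*} [Field F] {σ τ J : F →+* F} (H : FrobPair σ τ J)
include H

theorem τ_σ (x : F) : τ (σ x) = x := σ.injective (H.σ_τ _)

theorem τ_J (x : F) : τ (J x) = J (τ x) := σ.injective (by rw [H.σ_τ, H.σ_J, H.σ_τ])

theorem σ_eq_J_iff (x : F) : σ x = J x ↔ J x = x ∧ σ x = x := by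
  constructor
  · intro h
    have h1 : J x = x := H.fix x (by rw [h, H.σ_J, h, H.J_J]) (by rw [H.σ_J, h, H.J_J])
    exact ⟨h1, h.trans h1⟩
  · rintro ⟨h1, h2⟩; rw [h1, h2]

theorem eq_zero_of_anti {C : F} (h1 : J C = -C) (h2 : σ C = -C) : C = 0 := by
  have h3 : J C = C := H.fix C (by rw [h2, map_neg, h2, neg_neg]) (by rw [h1, map_neg, h2, neg_neg])
  have : 2 * C = 0 := by linear_combination h1 - h3
  exact (mul_eq_zero.mp this).resolve_left H.two_ne_zero

theorem mul_radMap (a b x : F) :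
    x * radMap σ τ J a b x = a * x * J x + b * x * σ x + τ (b * x * σ x) := by
  rw [radMap, map_mul τ (b * x), H.τ_σ]; ring

theorem J_eq_self_of_radMap_eq_zero {a b x : F} (ha : J a = a) (h : radMap σ τ J a b x = 0) :
    J (b * x * σ x) = b * x * σ x := by
  have h1 := H.mul_radMap a b x
  rw [h, mul_zero] at h1
  set B := b * x * σ x
  have h2 : a * x * J x + J B + τ (J B) = 0 := by
    have := congrArg J h1
    simp only [map_zero, map_add, map_mul, ha, H.J_J, ← H.τ_J] at this
    linear_combination -this
  have h3 : τ (B - J B) = -(B - J B) := by rw [map_sub]; linear_combination -h1 - h2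
  have h4 : B - J B = 0 := by
    refine H.eq_zero_of_anti (by rw [map_sub, H.J_J]; ring) ?_
    have := congrArg σ h3
    rw [H.σ_τ, map_neg] at this
    linear_combination this
  exact (sub_eq_zero.mp h4).symm

theorem radMap_mul_eq_zero_iff {a b x : F} (ha : J a = a) (hx : x ≠ 0)
    (h : radMap σ τ J a b x = 0) (t : F) :
    radMap σ τ J a b (x * t) = 0 ↔
      J (b * x * σ x * (σ t - J t)) = b * x * σ x * (σ t - J t) ∧
      σ (b * x * σ x * (σ t - J t)) = b * x * σ x * (σ t - J t) := by
  have hB := H.J_eq_self_of_radMap_eq_zero ha h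
  have h1 := H.mul_radMap a b x
  rw [h, mul_zero] at h1
  have h2 : x * radMap σ τ J a b (x * t)
      = b * x * σ x * (σ t - J t) - τ (b * x * σ x) * (J t - τ t) := by
    have : τ (b * x * σ x) = τ (b * x) * x := by rw [map_mul τ (b * x), H.τ_σ]
    have h3 : radMap σ τ J a b (x * t) = a * (J x * J t) + b * (σ x * σ t) + τ (b * x) * τ t := by
      rw [radMap, map_mul J, map_mul σ, ← mul_assoc b x t, map_mul τ (b * x)]
    rw [h3]
    rw [this] at h1 ⊢
    linear_combination -J t * h1
  rw [← H.σ_eq_J_iff]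
  generalize b * x * σ x = B at *
  have h3 : σ (τ B * (J t - τ t)) = J (B * (σ t - J t)) := by
    rw [map_mul σ, map_sub σ, map_mul J, map_sub J, H.σ_τ, H.σ_τ, H.σ_J, H.J_J, hB]
  rw [← h3, σ.injective.eq_iff, ← sub_eq_zero (b := _ * (J t - τ t)), ← h2]
  simp [hx]

theorem sub_eq_zero_iff (t : F) : σ t - J t = 0 ↔ J t = t ∧ σ t = t := by
  rw [sub_eq_zero, H.σ_eq_J_iff]

theorem exists_mul_sub_eq_one_iff {B : F} (hB : J B = B) :
    (∃ t, B * (σ t - J t) = 1) ↔ ∃ t, J t = t ∧ B * (σ t - t) = 1 := by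
  constructor
  · rintro ⟨t, ht⟩
    have hB0 : B ≠ 0 := by rintro rfl; simp at ht
    have h2 := congrArg J ht
    simp only [map_mul, map_sub, hB, H.J_J, map_one, ← H.σ_J] at h2
    have h3 : t - J t = 0 := by
      refine H.eq_zero_of_anti (by rw [map_sub, H.J_J]; ring) ?_
      rw [map_sub]
      apply mul_left_cancel₀ hB0
      linear_combination ht - h2
    have h4 : J t = t := (sub_eq_zero.mp h3).symm
    exact ⟨t, h4, by rw [h4] at ht; exact ht⟩
  · rintro ⟨t, h1, h2⟩
    exact ⟨t, by rw [h1]; exact h2⟩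

variable [Fintype F] [DecidableEq F]

theorem card_fixed_mul_sub {B : F} (hB : B ≠ 0) :
    #{t | J (B * (σ t - J t)) = B * (σ t - J t) ∧ σ (B * (σ t - J t)) = B * (σ t - J t)}
      = if ∃ t, B * (σ t - J t) = 1 then #{x | J x = x ∧ σ x = x} ^ 2
        else #{x | J x = x ∧ σ x = x} := by
  split_ifs with h
  · obtain ⟨t₀, ht₀⟩ := h
    have key : ∀ u v : F, J u = u ∧ σ u = u → J v = v ∧ σ v = v →
        B * (σ (u * t₀ + v) - J (u * t₀ + v)) = u := by
      rintro u v ⟨h1, h2⟩ ⟨h3, h4⟩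
      simp only [map_add, map_mul, h1, h2, h3, h4]
      linear_combination u * ht₀
    rw [sq, ← Finset.card_product]
    symm
    refine Finset.card_bij' (fun z _ => z.1 * t₀ + z.2)
      (fun t _ => (B * (σ t - J t), t - B * (σ t - J t) * t₀)) ?_ ?_ ?_ ?_
    · rintro ⟨u, v⟩ h
      simp only [mem_product, mem_filter, mem_univ, true_and] at h ⊢
      rw [key u v h.1 h.2]; exact h.1
    · intro t h
      simp only [mem_product, mem_filter, mem_univ, true_and] at h ⊢
      refine ⟨h, ?_⟩
      rw [← H.sub_eq_zero_iff]
      apply mul_left_cancel₀ hB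
      rw [map_sub, map_sub, map_mul _ _ t₀, map_mul _ _ t₀, h.1, h.2]
      linear_combination -(B * (σ t - J t)) * ht₀
    · rintro ⟨u, v⟩ h
      simp only [mem_product, mem_filter, mem_univ, true_and] at h
      dsimp only
      rw [key u v h.1 h.2]
      ext <;> simp
    · intro t h; ring
  · congr 1
    ext t
    simp only [mem_filter, mem_univ, true_and]
    rw [← H.sub_eq_zero_iff t]
    constructor
    · rintro ⟨h1, h2⟩
      by_contra h3
      apply h
      have hE : B * (σ t - J t) ≠ 0 := mul_ne_zero hB h3
      refine ⟨t / (B * (σ t - J t)), ?_⟩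
      rw [map_div₀, map_div₀, h1, h2]
      field_simp
    · intro h1; simp [h1]

theorem card_exists_mul_sub_eq_one :
    #{x | J x = x ∧ σ x = x} * (#{B | J B = B ∧ B ≠ 0 ∧ ∃ t, B * (σ t - J t) = 1} + 1)
      = #{x | J x = x} := by
  have h1 : #{B | J B = B ∧ B ≠ 0 ∧ ∃ t, B * (σ t - J t) = 1} + 1
      = #(({t | J t = t} : Finset F).image fun t => σ t - t) := by
    have h0 : (0 : F) ∈ ({t | J t = t} : Finset F).image fun t => σ t - t :=
      mem_image.mpr ⟨0, by simp, by simp⟩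
    rw [← Finset.card_erase_add_one h0]
    congr 1
    refine Finset.card_bij' (fun B _ => B⁻¹) (fun B _ => B⁻¹) ?_ ?_ ?_ ?_
    · intro B hB
      simp only [mem_filter, mem_univ, true_and] at hB
      obtain ⟨hB, hB0, h⟩ := hB
      rw [H.exists_mul_sub_eq_one_iff hB] at h
      obtain ⟨t, h1, h2⟩ := h
      simp only [mem_erase, mem_image, mem_filter, mem_univ, true_and]
      exact ⟨inv_ne_zero hB0, t, h1, eq_inv_of_mul_eq_one_right h2⟩
    · intro z hz
      simp only [mem_erase, mem_image, mem_filter, mem_univ, true_and] at hz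
      obtain ⟨hz0, t, h1, rfl⟩ := hz
      have h3 : J (σ t - t)⁻¹ = (σ t - t)⁻¹ := by rw [map_inv₀, map_sub, ← H.σ_J, h1]
      simp only [mem_filter, mem_univ, true_and]
      rw [H.exists_mul_sub_eq_one_iff h3]
      exact ⟨h3, inv_ne_zero hz0, t, h1, inv_mul_cancel₀ hz0⟩
    · intro B _; exact inv_inv B
    · intro B _; exact inv_inv B
  rw [h1, Finset.card_eq_sum_card_image (fun t => σ t - t) ({t | J t = t} : Finset F),
    Finset.sum_const_nat (m := #{x | J x = x ∧ σ x = x}), mul_comm]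
  intro z hz
  obtain ⟨t₀, ht₀, rfl⟩ := mem_image.mp hz
  simp only [mem_filter, mem_univ, true_and] at ht₀
  refine Finset.card_bij' (fun t _ => t - t₀) (fun t _ => t + t₀) ?_ ?_ ?_ ?_
  · intro t ht
    simp only [mem_filter, mem_univ, true_and] at ht ⊢
    exact ⟨by rw [map_sub, ht.1, ht₀], by rw [map_sub]; linear_combination ht.2⟩
  · intro t ht
    simp only [mem_filter, mem_univ, true_and] at ht ⊢
    exact ⟨by rw [map_add, ht.1, ht₀], by rw [map_add]; linear_combination ht.2⟩
  · intro t _; ring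
  · intro t _; ring

theorem card_radMap_eq {a b x : F} (ha : J a = a) (hb : b ≠ 0) (hx : x ≠ 0)
    (h : radMap σ τ J a b x = 0) :
    #{y | radMap σ τ J a b y = 0}
      = if ∃ t, b * x * σ x * (σ t - J t) = 1 then #{x | J x = x ∧ σ x = x} ^ 2
        else #{x | J x = x ∧ σ x = x} := by
  have hB : b * x * σ x ≠ 0 := mul_ne_zero (mul_ne_zero hb hx) ((map_ne_zero σ).mpr hx)
  rw [← H.card_fixed_mul_sub hB]
  symm
  refine Finset.card_bij' (fun t _ => x * t) (fun y _ => x⁻¹ * y) ?_ ?_ ?_ ?_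
  · intro t ht
    simp only [mem_filter, mem_univ, true_and] at ht ⊢
    exact (H.radMap_mul_eq_zero_iff ha hx h t).mpr ht
  · intro y hy
    simp only [mem_filter, mem_univ, true_and] at hy ⊢
    rw [← H.radMap_mul_eq_zero_iff ha hx h, mul_inv_cancel_left₀ hx]
    exact hy
  · intro t _; exact inv_mul_cancel_left₀ hx t
  · intro t _; exact mul_inv_cancel_left₀ hx t

/-- Coefficient pairs with a given nonzero radical vector `x` are parametrised by
`b * x * σ x`, which runs over the nonzero elements of the fixed field of `J`. -/
theorem card_pairs_of_mem {x : F} (hx : x ≠ 0) (P : F → Prop) [DecidablePred P] :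
    #{z : F × F | J z.1 = z.1 ∧ z.2 ≠ 0 ∧ radMap σ τ J z.1 z.2 x = 0 ∧ P (z.2 * x * σ x)}
      = #{B | J B = B ∧ B ≠ 0 ∧ P B} := by
  have hσx : σ x ≠ 0 := (map_ne_zero σ).mpr hx
  have hJx : J x ≠ 0 := (map_ne_zero J).mpr hx
  refine Finset.card_bij' (fun z _ => z.2 * x * σ x)
    (fun B _ => (-(B + τ B) / (x * J x), B / (x * σ x))) ?_ ?_ ?_ ?_
  · rintro ⟨a, b⟩ h
    simp only [mem_filter, mem_univ, true_and] at h ⊢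
    obtain ⟨ha, hb, hr, hP⟩ := h
    exact ⟨H.J_eq_self_of_radMap_eq_zero ha hr, mul_ne_zero (mul_ne_zero hb hx) hσx, hP⟩
  · intro B h
    simp only [mem_filter, mem_univ, true_and] at h ⊢
    obtain ⟨hB, hB0, hP⟩ := h
    have hb : B / (x * σ x) * x * σ x = B := by field_simp
    refine ⟨?_, div_ne_zero hB0 (mul_ne_zero hx hσx), ?_, by rwa [hb]⟩
    · rw [map_div₀, map_neg, map_add, ← H.τ_J, hB, map_mul, H.J_J, mul_comm x]
    · apply mul_left_cancel₀ hx
      rw [H.mul_radMap, hb]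
      field_simp
      ring
  · rintro ⟨a, b⟩ h
    simp only [mem_filter, mem_univ, true_and] at h
    obtain ⟨ha, hb, hr, hP⟩ := h
    have h1 := H.mul_radMap a b x
    rw [hr, mul_zero] at h1
    ext
    · dsimp only
      rw [div_eq_iff (mul_ne_zero hx hJx)]
      linear_combination h1
    · dsimp only
      field_simp
  · intro B h
    dsimp only
    field_simp

theorem card_pairs_mul (c : ℕ) (P : F → Prop) [DecidablePred P]
    (hP : ∀ a b x, J a = a → b ≠ 0 → x ≠ 0 → radMap σ τ J a b x = 0 →
      (#{y | radMap σ τ J a b y = 0} = c ↔ P (b * x * σ x))) :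
    #{z : F × F | J z.1 = z.1 ∧ z.2 ≠ 0 ∧ #{y | radMap σ τ J z.1 z.2 y = 0} = c} * (c - 1)
      = (Fintype.card F - 1) * #{B | J B = B ∧ B ≠ 0 ∧ P B} := by
  have hdc := Finset.sum_card_bipartiteAbove_eq_sum_card_bipartiteBelow
    (s := {z : F × F | J z.1 = z.1 ∧ z.2 ≠ 0 ∧ #{y | radMap σ τ J z.1 z.2 y = 0} = c})
    (t := univ.erase (0 : F)) (fun z x => radMap σ τ J z.1 z.2 x = 0)
  rw [Finset.sum_const_nat (m := c - 1), Finset.sum_const_nat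
    (m := #{B | J B = B ∧ B ≠ 0 ∧ P B})] at hdc
  · rw [hdc, Finset.card_erase_of_mem (mem_univ _), Finset.card_univ]
  · intro x hx
    have hx0 := (mem_erase.mp hx).1
    rw [← H.card_pairs_of_mem hx0 P, bipartiteBelow, Finset.filter_filter]
    congr 1
    ext z
    simp only [mem_filter, mem_univ, true_and]
    constructor
    · rintro ⟨⟨h1, h2, h3⟩, h4⟩
      exact ⟨h1, h2, h4, (hP _ _ _ h1 h2 hx0 h4).mp h3⟩
    · rintro ⟨h1, h2, h4, h3⟩
      exact ⟨⟨h1, h2, (hP _ _ _ h1 h2 hx0 h4).mpr h3⟩, h4⟩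
  · rintro ⟨a, b⟩ hz
    simp only [mem_filter, mem_univ, true_and] at hz
    rw [bipartiteAbove, Finset.filter_erase, Finset.card_erase_of_mem, hz.2.2]
    simp [radMap]

theorem card_radMap_trichotomy {a b : F} (ha : J a = a) (hab : (a, b) ≠ 0) :
    #{y | radMap σ τ J a b y = 0} = 1 ∨
    b ≠ 0 ∧ (#{y | radMap σ τ J a b y = 0} = #{x | J x = x ∧ σ x = x} ∨
      #{y | radMap σ τ J a b y = 0} = #{x | J x = x ∧ σ x = x} ^ 2) := by
  by_cases h : ∃ x, x ≠ 0 ∧ radMap σ τ J a b x = 0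
  · obtain ⟨x, hx, h⟩ := h
    have hb : b ≠ 0 := by
      rintro rfl
      simp [radMap, hx] at h
      exact hab (by simp [h])
    refine Or.inr ⟨hb, ?_⟩
    rw [H.card_radMap_eq ha hb hx h]
    split_ifs
    · exact Or.inr rfl
    · exact Or.inl rfl
  · left
    rw [Finset.card_eq_one]
    refine ⟨0, ?_⟩
    ext y
    simp only [mem_filter, mem_univ, true_and, mem_singleton]
    constructor
    · intro h1; by_contra h2; exact h ⟨y, h2, h1⟩
    · rintro rfl; simp [radMap]

theorem card_pairs_sq_mul (hδ : 1 < #{x | J x = x ∧ σ x = x}) :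
    #{z : F × F | J z.1 = z.1 ∧ z.2 ≠ 0 ∧
        #{y | radMap σ τ J z.1 z.2 y = 0} = #{x | J x = x ∧ σ x = x} ^ 2}
        * (#{x | J x = x ∧ σ x = x} ^ 2 - 1)
      = (Fintype.card F - 1) * #{B | J B = B ∧ B ≠ 0 ∧ ∃ t, B * (σ t - J t) = 1} := by
  refine H.card_pairs_mul _ _ fun a b x ha hb hx h => ?_
  rw [H.card_radMap_eq ha hb hx h]
  split_ifs with h1
  · simp [h1]
  · simp only [h1, iff_false]
    nlinarith

theorem card_pairs_self_mul (hδ : 1 < #{x | J x = x ∧ σ x = x}) :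
    #{z : F × F | J z.1 = z.1 ∧ z.2 ≠ 0 ∧
        #{y | radMap σ τ J z.1 z.2 y = 0} = #{x | J x = x ∧ σ x = x}}
        * (#{x | J x = x ∧ σ x = x} - 1)
      = (Fintype.card F - 1) * #{B | J B = B ∧ B ≠ 0 ∧ ¬ ∃ t, B * (σ t - J t) = 1} := by
  refine H.card_pairs_mul _ _ fun a b x ha hb hx h => ?_
  rw [H.card_radMap_eq ha hb hx h]
  split_ifs with h1
  · simp only [h1, not_true, iff_false]
    nlinarith
  · simp [h1]

end FrobPair

end Radical

section Frobenius

theorem pow_gcd_eq_self {F : Type*} [Field F] {p : ℕ} [Fact p.Prime] [CharP F p] {i j : ℕ} {x : F}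
    (hi : x ^ p ^ i = x) (hj : x ^ p ^ j = x) : x ^ p ^ Nat.gcd i j = x := by
  have h : ∀ n, x ^ p ^ n = x ↔ Function.IsPeriodicPt (frobenius F p) n x := by
    intro n; rw [Function.IsPeriodicPt, Function.IsFixedPt, iterate_frobenius]
  rw [h] at hi hj ⊢
  exact hi.gcd hj

theorem pow_eq_self_of_dvd {F : Type*} [Field F] {p : ℕ} [Fact p.Prime] [CharP F p] {i j : ℕ} {x : F}
    (hij : i ∣ j) (hi : x ^ p ^ i = x) : x ^ p ^ j = x := by
  have h : ∀ n, x ^ p ^ n = x ↔ Function.IsPeriodicPt (frobenius F p) n x := by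
    intro n; rw [Function.IsPeriodicPt, Function.IsFixedPt, iterate_frobenius]
  rw [h] at hi ⊢
  exact hi.trans_dvd hij

theorem card_pow_eq_self {F : Type*} [Field F] [Fintype F] [DecidableEq F] {p N n : ℕ} (hp : 1 < p)
    (hF : Fintype.card F = p ^ N) (hn : n ≠ 0) (hnN : n ∣ N) :
    (Finset.univ.filter fun x : F => x ^ p ^ n = x).card = p ^ n := by
  have h1 : 1 < p ^ n := Nat.one_lt_pow hn hp
  have h0 : (0 : F) ∈ Finset.univ.filter fun x : F => x ^ p ^ n = x := by
    simp [zero_pow (by omega : p ^ n ≠ 0)]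
  have hk := IsCyclic.card_powMonoidHom_ker (G := Fˣ) (p ^ n - 1)
  have hdvd : p ^ n - 1 ∣ p ^ N - 1 := by
    obtain ⟨c, rfl⟩ := hnN
    rw [pow_mul]
    simpa using Nat.sub_dvd_pow_sub_pow (p ^ n) 1 c
  rw [Nat.card_eq_fintype_card (α := Fˣ), Fintype.card_units, hF, Nat.gcd_eq_right hdvd] at hk
  have : (Finset.univ.filter fun x : F => x ^ p ^ n = x).card
      = (Finset.univ.filter fun u : Fˣ => u ^ (p ^ n - 1) = 1).card + 1 := by
    rw [← Finset.card_erase_add_one h0]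
    congr 1
    symm
    have hpow : ∀ x : F, x ^ p ^ n = x ^ (p ^ n - 1) * x := by
      intro x; rw [← pow_succ]; congr 1; omega
    refine Finset.card_bij (fun u _ => (u : F)) ?_ ?_ ?_
    · intro u hu
      simp only [Finset.mem_filter, Finset.mem_univ, true_and, Finset.mem_erase] at hu ⊢
      refine ⟨u.ne_zero, ?_⟩
      rw [hpow, ← Units.val_pow_eq_pow_val, hu]; simp
    · intro u _ v _ h; exact Units.ext h
    · intro x hx
      simp only [Finset.mem_filter, Finset.mem_univ, true_and, Finset.mem_erase] at hx
      refine ⟨Units.mk0 x hx.1, ?_, rfl⟩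
      simp only [Finset.mem_filter, Finset.mem_univ, true_and]
      ext
      apply mul_right_cancel₀ hx.1
      have := hx.2
      rw [hpow] at this
      simpa using this
  have hker : Nat.card (powMonoidHom (p ^ n - 1) : Fˣ →* Fˣ).ker
      = (Finset.univ.filter fun u : Fˣ => u ^ (p ^ n - 1) = 1).card := by
    rw [Nat.card_eq_fintype_card]
    exact Fintype.card_of_subtype _ (by simp [MonoidHom.mem_ker])
  rw [this, ← hker, hk]
  omega

end Frobenius

section TraceForm

open Finset

variable {p : ℕ} [Fact p.Prime] {F : Type} [Field F] [Fintype F] [CharP F p]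

omit [Fintype F] in
theorem trp_add (r : ℕ) (x y : F) : trp p r (x + y) = trp p r x + trp p r y := by
  simp [trp, add_pow_char_pow, Finset.sum_add_distrib]

variable [Algebra (ZMod p) F]

omit [CharP F p] in
theorem finrank_of_card {n : ℕ} (hF : Fintype.card F = p ^ n) : Module.finrank (ZMod p) F = n := by
  have := Module.card_eq_pow_finrank (K := ZMod p) (V := F)
  rw [hF, ZMod.card] at this
  exact (Nat.pow_right_injective (Fact.out : p.Prime).two_le this).symm

omit [CharP F p] in
theorem trp_eq_algebraMap_trace {n : ℕ} (hF : Fintype.card F = p ^ n) (z : F) :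
    trp p n z = algebraMap (ZMod p) F (Algebra.trace (ZMod p) F z) := by
  rw [FiniteField.algebraMap_trace_eq_sum_pow, finrank_of_card hF, Nat.card_zmod, trp]

omit [CharP F p] in
theorem trace_pow_char_pow (i : ℕ) (z : F) :
    Algebra.trace (ZMod p) F (z ^ p ^ i) = Algebra.trace (ZMod p) F z := by
  induction i with
  | zero => simp
  | succ i ih =>
    have h := Algebra.trace_eq_of_algEquiv
      (FiniteField.frobeniusAlgEquivOfAlgebraic (ZMod p) F) (z ^ p ^ i)
    rw [FiniteField.coe_frobeniusAlgEquivOfAlgebraic, ZMod.card] at h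
    rw [pow_succ, pow_mul]
    exact h.trans ih

theorem trp_half {s : ℕ} (h2 : (2 : F) ≠ 0) (hF : Fintype.card F = p ^ (2 * s)) {w : F}
    (hw : w ^ p ^ s = w) :
    trp p s w = algebraMap (ZMod p) F (Algebra.trace (ZMod p) F (2⁻¹ * w)) := by
  rw [← trp_eq_algebraMap_trace hF]
  apply mul_left_cancel₀ h2
  have h1 : 2 * trp p (2 * s) (2⁻¹ * w) = trp p (2 * s) w := by
    rw [two_mul, ← trp_add, ← add_mul, ← two_mul, mul_inv_cancel₀ h2, one_mul]
  rw [h1, two_mul (trp p s w), trp, trp, two_mul s, Finset.sum_range_add]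
  congr 1
  refine Finset.sum_congr rfl fun i _ => ?_
  rw [pow_add, pow_mul, hw]

/-- The bilinear form `(x, y) ↦ Tr (a x y^(p^s) / 2 + b x y^(p^l))`. -/
noncomputable def frobForm (p s l : ℕ) [Fact p.Prime] {F : Type} [Field F] [CharP F p]
    [Algebra (ZMod p) F] (a b : F) : F →ₗ[ZMod p] F →ₗ[ZMod p] ZMod p :=
  LinearMap.mk₂ (ZMod p)
    (fun x y => Algebra.trace (ZMod p) F
      (2⁻¹ * (a * (x * iterateFrobenius F p s y)) + b * (x * iterateFrobenius F p l y)))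
    (fun x x' y => by rw [← map_add]; congr 1; ring)
    (fun c x y => by
      rw [← map_smul]; congr 1; simp only [smul_add, mul_smul_comm, smul_mul_assoc])
    (fun x y y' => by rw [← map_add]; congr 1; simp only [map_add]; ring)
    (fun c x y => by
      rw [← map_smul]; congr 1; simp only [smul_add, mul_smul_comm, ZMod.map_smul])

omit [Fintype F] in
theorem frobForm_apply (s l : ℕ) (a b x y : F) :
    frobForm p s l a b x y = Algebra.trace (ZMod p) F
      (2⁻¹ * (a * (x * iterateFrobenius F p s y)) + b * (x * iterateFrobenius F p l y)) := rfl

omit [Fintype F] [Algebra (ZMod p) F] in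
theorem iterateFrobenius_comp_apply (i j : ℕ) (x : F) :
    iterateFrobenius F p i (iterateFrobenius F p j x) = x ^ p ^ (i + j) := by
  rw [iterateFrobenius_def, iterateFrobenius_def, ← pow_mul, ← pow_add, add_comm]

omit [Algebra (ZMod p) F] in
theorem frobPair {s l d : ℕ} (h2 : (2 : F) ≠ 0) (hF : Fintype.card F = p ^ (2 * s)) (hl : l ≤ 2 * s)
    (hd : Nat.gcd s l = d) (hd' : Nat.gcd (s + l) (2 * l) = d) :
    FrobPair (iterateFrobenius F p l) (iterateFrobenius F p (2 * s - l))
      (iterateFrobenius F p s) where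
  J_J x := by rw [iterateFrobenius_comp_apply, ← two_mul, ← hF, FiniteField.pow_card]
  σ_τ x := by rw [iterateFrobenius_comp_apply, Nat.add_sub_cancel' hl, ← hF, FiniteField.pow_card]
  σ_J x := by rw [iterateFrobenius_comp_apply, iterateFrobenius_comp_apply, add_comm]
  fix x h3 h4 := by
    rw [iterateFrobenius_comp_apply] at h3 h4
    rw [← two_mul] at h3
    rw [add_comm] at h4
    have := pow_gcd_eq_self h4 h3
    rw [hd', ← hd] at this
    exact pow_eq_self_of_dvd (Nat.gcd_dvd_left s l) this
  two_ne_zero := h2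

omit [CharP F p] in
theorem eq_zero_of_trace_mul_eq_zero (z : F) (h : ∀ y, Algebra.trace (ZMod p) F (z * y) = 0) :
    z = 0 :=
  (traceForm_nondegenerate (ZMod p) F).1 z h

theorem mem_ker_frobForm_iff {s l d : ℕ} (h2 : (2 : F) ≠ 0) (hF : Fintype.card F = p ^ (2 * s))
    (hl : l ≤ 2 * s) (hd : Nat.gcd s l = d) (hd' : Nat.gcd (s + l) (2 * l) = d) {a b : F}
    (ha : iterateFrobenius F p s a = a) (x : F) :
    x ∈ LinearMap.ker (frobForm p s l a b + (frobForm p s l a b).flip) ↔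
      radMap (iterateFrobenius F p l) (iterateFrobenius F p (2 * s - l))
        (iterateFrobenius F p s) a b x = 0 := by
  have H := frobPair h2 hF hl hd hd'
  have key : ∀ y, (frobForm p s l a b + (frobForm p s l a b).flip) x y
      = Algebra.trace (ZMod p) F (radMap (iterateFrobenius F p l) (iterateFrobenius F p (2 * s - l))
        (iterateFrobenius F p s) a b x * y) := by
    intro y
    have htr : ∀ i z, Algebra.trace (ZMod p) F (iterateFrobenius F p i z)
        = Algebra.trace (ZMod p) F z := by
      intro i z; rw [iterateFrobenius_def, trace_pow_char_pow]
    have hhalf : iterateFrobenius F p s (2⁻¹ : F) = 2⁻¹ := by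
      rw [map_inv₀, map_ofNat]
    have e1 : Algebra.trace (ZMod p) F (2⁻¹ * (a * (x * iterateFrobenius F p s y)))
        = Algebra.trace (ZMod p) F (2⁻¹ * (a * (iterateFrobenius F p s x * y))) := by
      rw [← htr s, map_mul (iterateFrobenius F p s), map_mul (iterateFrobenius F p s),
        map_mul (iterateFrobenius F p s), hhalf, ha, H.J_J]
    have e2 : Algebra.trace (ZMod p) F (b * (x * iterateFrobenius F p l y))
        = Algebra.trace (ZMod p) F (iterateFrobenius F p (2 * s - l) (b * x) * y) := by
      rw [← htr (2 * s - l), ← mul_assoc, map_mul _ (b * x), H.τ_σ]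
    rw [LinearMap.add_apply, LinearMap.add_apply, LinearMap.flip_apply, frobForm_apply,
      frobForm_apply, map_add, e1, e2, ← map_add, ← map_add]
    congr 1
    rw [radMap]
    field_simp
    ring
  rw [LinearMap.mem_ker]
  constructor
  · intro h
    apply eq_zero_of_trace_mul_eq_zero (p := p)
    intro y
    rw [← key, h, LinearMap.zero_apply]
  · intro h
    ext y
    rw [key, h, zero_mul, map_zero, LinearMap.zero_apply]

end TraceForm

section Main

open Finset

variable {p : ℕ} [Fact p.Prime] {F : Type} [Field F] [Fintype F] [DecidableEq F] [CharP F p]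

omit [DecidableEq F] in
theorem cword_eq [Algebra (ZMod p) F] {s l : ℕ} (h2 : (2 : F) ≠ 0)
    (hF : Fintype.card F = p ^ (2 * s)) {a b c : F} (ha : a ^ p ^ s = a) (h : ZMod p) (x : F) :
    cword p s l a b c h x = algebraMap (ZMod p) F
      (frobForm p s l a b x x + Algebra.trace (ZMod p) F (c * x) + h) := by
  have hw : (a * x ^ (p ^ s + 1)) ^ p ^ s = a * x ^ (p ^ s + 1) := by
    rw [mul_pow, ha, ← pow_mul, add_mul, ← pow_add, ← two_mul, pow_add, ← hF,
      FiniteField.pow_card, one_mul, pow_succ' x]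
  have hcast : (ZMod.cast h : F) = algebraMap (ZMod p) F h :=
    RingHom.congr_fun (Subsingleton.elim (ZMod.castHom (dvd_refl p) F) (algebraMap (ZMod p) F)) h
  rw [cword, trp_half h2 hF hw, trp_eq_algebraMap_trace hF, frobForm_apply, hcast, ← map_add,
    ← map_add, ← map_add, ← map_add]
  simp only [iterateFrobenius_def]
  congr 3
  ring

theorem card_suppw_eq_iff [Algebra (ZMod p) F] {s l : ℕ} (hs : 1 ≤ s) (h2 : (2 : F) ≠ 0)
    (hF : Fintype.card F = p ^ (2 * s)) {a b c : F} (ha : a ^ p ^ s = a) (h : ZMod p) :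
    (suppw p s l a b c h).card = p ^ (2 * s - 1) * (p - 1) ↔
      #{x | frobForm p s l a b x x + Algebra.trace (ZMod p) F (c * x) + h = 0}
        = p ^ (2 * s - 1) := by
  have h1 : (suppw p s l a b c h).card
      + #{x | frobForm p s l a b x x + Algebra.trace (ZMod p) F (c * x) + h = 0}
      = p ^ (2 * s) := by
    rw [← hF, ← Finset.card_univ, add_comm, ← Finset.card_filter_add_card_filter_not
      (s := (univ : Finset F)) (fun x => frobForm p s l a b x x + Algebra.trace (ZMod p) F (c * x) + h = 0), suppw]
    congr 2
    ext x
    simp only [mem_filter, mem_univ, true_and, cword_eq h2 hF ha, ne_eq, map_eq_zero]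
  have h3 : p ^ (2 * s) = p ^ (2 * s - 1) * (p - 1) + p ^ (2 * s - 1) := by
    have : 1 ≤ p := (Fact.out : p.Prime).one_le
    rw [← Nat.mul_succ, Nat.succ_eq_add_one, Nat.sub_add_cancel this, ← pow_succ]
    congr 1; omega
  omega

/-- The number of affine perturbations having exactly `p^(m-1)` zeros, for a quadratic form in
`m` variables whose radical has dimension `k`. -/
def perturbCount (p m k : ℕ) : ℤ :=
  p * (p ^ m - p ^ (m - k)) + if Even (m + k) then 0 else (p : ℤ) ^ (m - k)

theorem card_codewords_of_pair {s l d k : ℕ} (hp : p ≠ 2) (hs : 1 ≤ s) (h2 : (2 : F) ≠ 0)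
    (hF : Fintype.card F = p ^ (2 * s)) (hl : l ≤ 2 * s)
    (hd : Nat.gcd s l = d) (hd' : Nat.gcd (s + l) (2 * l) = d) {a b : F}
    (ha : iterateFrobenius F p s a = a)
    (hk : #{y | radMap (iterateFrobenius F p l) (iterateFrobenius F p (2 * s - l))
        (iterateFrobenius F p s) a b y = 0} = p ^ k) :
    (#{z : F × ZMod p | (suppw p s l a b z.1 z.2).card = p ^ (2 * s - 1) * (p - 1)} : ℤ)
      = perturbCount p (2 * s) k := by
  let _ := ZMod.algebra F p
  have hker : Nat.card (LinearMap.ker (frobForm p s l a b + (frobForm p s l a b).flip)) = p ^ k := by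
    classical
    rw [← hk, Nat.card_eq_fintype_card]
    refine Fintype.card_of_subtype _ fun x => ?_
    rw [mem_ker_frobForm_iff h2 hF hl hd hd' ha]
    simp
  have := card_perturbation (frobForm p s l a b) hp (by omega) hF hker
  push_cast at this
  rw [perturbCount, ← this, ← Fintype.card_subtype,
    ← Nat.card_eq_fintype_card]
  congr 1
  have hnd := traceForm_nondegenerate (ZMod p) F
  refine Nat.card_congr (Equiv.subtypeEquiv
    ((LinearMap.BilinForm.toDual _ hnd).toEquiv.prodCongr (Equiv.refl _)) ?_)
  rintro ⟨c, h⟩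
  rw [iterateFrobenius_def] at ha
  rw [card_suppw_eq_iff hs h2 hF ha]
  rfl

theorem card_fixed_eq_add (σ J : F →+* F) :
    #{B | J B = B ∧ B ≠ 0 ∧ ∃ t, B * (σ t - J t) = 1}
      + #{B | J B = B ∧ B ≠ 0 ∧ ¬ ∃ t, B * (σ t - J t) = 1} + 1 = #{x | J x = x} := by
  have h0 : (0 : F) ∈ ({x | J x = x} : Finset F) := by simp
  rw [← Finset.card_erase_add_one h0,
    ← Finset.card_filter_add_card_filter_not (s := ({x | J x = x} : Finset F).erase 0)
      (fun B => ∃ t, B * (σ t - J t) = 1)]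
  congr 3
  all_goals
    ext B
    simp only [mem_filter, mem_univ, true_and, mem_erase]
    tauto

theorem sum_of_card_radMap {σ τ J : F →+* F} (H : FrobPair σ τ J) {p n d : ℕ} (hp : 1 < p)
    (hd : d ≠ 0) (hF : Fintype.card F = p ^ n) (hδ : #{x | J x = x ∧ σ x = x} = p ^ d)
    (f : F → F → ℕ) (W : ℕ → ℤ) (hW : W 0 = 0)
    (hf : ∀ a b k, J a = a → #{y | radMap σ τ J a b y = 0} = p ^ k → (f a b : ℤ) = W k) :
    ((∑ z : F × F, if J z.1 = z.1 then f z.1 z.2 else 0 : ℕ) : ℤ)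
      = W n + #{z : F × F | J z.1 = z.1 ∧ z.2 ≠ 0 ∧ #{y | radMap σ τ J z.1 z.2 y = 0} = p ^ d} * W d
        + #{z : F × F | J z.1 = z.1 ∧ z.2 ≠ 0 ∧ #{y | radMap σ τ J z.1 z.2 y = 0} = (p ^ d) ^ 2}
          * W (2 * d) := by
  have h1 : 1 < p ^ d := Nat.one_lt_pow hd hp
  have hpt : ∀ z : F × F, ((if J z.1 = z.1 then f z.1 z.2 else 0 : ℕ) : ℤ)
      = (if z = 0 then W n else 0)
        + (if J z.1 = z.1 ∧ z.2 ≠ 0 ∧ #{y | radMap σ τ J z.1 z.2 y = 0} = p ^ d then W d else 0)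
        + (if J z.1 = z.1 ∧ z.2 ≠ 0 ∧ #{y | radMap σ τ J z.1 z.2 y = 0} = (p ^ d) ^ 2
            then W (2 * d) else 0) := by
    rintro ⟨a, b⟩
    by_cases ha : J a = a
    · simp only [ha, if_true, true_and]
      by_cases hab : (a, b) = 0
      · obtain ⟨rfl, rfl⟩ := Prod.mk_eq_zero.mp hab
        rw [hf 0 0 n (map_zero J) (by simp [radMap, hF])]
        simp
      · have hne : p ^ d ≠ (p ^ d) ^ 2 := by nlinarith
        have hne' : 1 ≠ (p ^ d) ^ 2 := by nlinarith
        rcases H.card_radMap_trichotomy ha hab with h3 | ⟨hb, h3 | h3⟩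
        · rw [hf a b 0 ha (by rw [h3, pow_zero]), h3, hW, if_neg hab, if_neg (fun h => h1.ne h.2),
            if_neg (fun h => hne' h.2)]
          rfl
        · rw [hf a b d ha (h3.trans hδ), h3, hδ, if_neg hab, if_pos ⟨hb, rfl⟩,
            if_neg (fun h => hne h.2)]
          ring
        · rw [hf a b (2 * d) ha (by rw [h3, hδ]; ring), h3, hδ, if_neg hab,
            if_neg (fun h => hne h.2.symm), if_pos ⟨hb, rfl⟩]
          ring
    · have hab : (a, b) ≠ 0 := by
        intro h; apply ha; rw [(Prod.mk_eq_zero.mp h).1, map_zero]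
      simp [ha, hab]
  rw [Nat.cast_sum, Finset.sum_congr rfl fun z _ => hpt z, Finset.sum_add_distrib,
    Finset.sum_add_distrib, Finset.sum_ite_eq', ← Finset.sum_filter, ← Finset.sum_filter,
    Finset.sum_const, Finset.sum_const]
  simp only [mem_univ, if_true, nsmul_eq_mul]

theorem card_filter_quadruple {α β γ ι : Type*} [Fintype α] [Fintype β] [Fintype γ] [Fintype ι]
    (P : α → Prop) [DecidablePred P] (Q : α → β → γ → ι → Prop)
    [∀ a b c h, Decidable (Q a b c h)] :
    #{t : α × β × γ × ι | P t.1 ∧ Q t.1 t.2.1 t.2.2.1 t.2.2.2}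
      = ∑ z : α × β, if P z.1 then #{w : γ × ι | Q z.1 z.2 w.1 w.2} else 0 := by
  rw [Finset.card_filter, Fintype.sum_prod_type, Fintype.sum_prod_type]
  refine Finset.sum_congr rfl fun a _ => ?_
  rw [Fintype.sum_prod_type]
  refine Finset.sum_congr rfl fun b _ => ?_
  dsimp only
  split_ifs with ha
  · simp only [Finset.card_filter, ha, true_and]
  · simp [ha]

theorem weight_count_identity {p q n1 n2 c1 c2 : ℚ} {g e : ℕ} (hg : p ^ (g + 1) ≠ 1)
    (hq : q = p ^ (2 * (g + 1 + e))) (h2 : c2 + 1 = p ^ e) (h1 : c2 + c1 + 1 = p ^ (g + 1 + e))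
    (hn1 : n1 * (p ^ (g + 1) - 1) = (q - 1) * c1)
    (hn2 : n2 * ((p ^ (g + 1)) ^ 2 - 1) = (q - 1) * c2) :
    p * (q - 1) + n1 * (p * (q - p ^ (g + 1 + 2 * e)) + p ^ (g + 1 + 2 * e))
        + n2 * (p * (q - p ^ (2 * e)))
      = p * (p ^ (2 * (g + 1) + 3 * e) - p ^ (g + 1 + 3 * e) + p ^ (g + 3 * e) + p ^ (3 * e)
        - p ^ (2 * e) + 1) * (q - 1) := by
  have hn1' : n1 = (q - 1) * p ^ e := by
    apply mul_right_cancel₀ (sub_ne_zero.mpr hg)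
    rw [hn1, show c1 = p ^ (g + 1 + e) - p ^ e by linear_combination h1 - h2]
    ring
  have hn2' : n2 * (p * (q - p ^ (2 * e))) = (q - 1) * (p ^ e - 1) * p * p ^ (2 * e) := by
    rw [hq] at hn2 ⊢
    have hc2 : c2 = p ^ e - 1 := by linear_combination h2
    rw [hc2] at hn2
    linear_combination p * p ^ (2 * e) * hn2
  rw [hn2', hn1', hq]
  ring

end Main

theorem stmt7 (p s l : ℕ) [Fact p.Prime] (F : Type) [Field F] [Fintype F] [DecidableEq F]
    [CharP F p] (hodd : Odd p) (hs : 2 ≤ s) (hl1 : 1 ≤ l) (hls : l ≠ s)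
    (hl2 : l ≤ 2 * s - 1) (hF : Fintype.card F = p ^ (2 * s)) (d : ℕ)
    (hd : Nat.gcd s l = d) (hd' : Nat.gcd (s + l) (2 * l) = d) (hdodd : Odd d) :
    (((Finset.univ : Finset (F × F × F × ZMod p)).filter fun t =>
        t.1 ^ p ^ s = t.1 ∧ (suppw p s l t.1 t.2.1 t.2.2.1 t.2.2.2).card
          = p ^ (2 * s - 1) * (p - 1)).card : ℚ)
      = (p : ℚ) * ((p : ℚ) ^ (3 * s - d) - (p : ℚ) ^ (3 * s - 2 * d) + (p : ℚ) ^ (3 * s - 2 * d - 1)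
            + (p : ℚ) ^ (3 * s - 3 * d) - (p : ℚ) ^ (2 * s - 2 * d) + 1) * ((p : ℚ) ^ (2 * s) - 1) := by
  classical
  have pp : p.Prime := Fact.out
  have hp : p ≠ 2 := by rintro rfl; exact absurd hodd (by decide)
  have h2 : (2 : F) ≠ 0 := Ring.two_ne_zero (by rwa [ringChar.eq F p])
  have hl : l ≤ 2 * s := by omega
  have hd0 : 1 ≤ d := hdodd.pos
  have hds : 2 * d ≤ s := by
    have h1 : d ∣ s := hd ▸ Nat.gcd_dvd_left s l
    have h3 : d ∣ l := hd ▸ Nat.gcd_dvd_right s l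
    obtain ⟨u, rfl⟩ := h1
    obtain ⟨v, rfl⟩ := h3
    have : u ≠ 1 := by
      rintro rfl
      have : v < 2 := by
        by_contra hv
        have := Nat.mul_le_mul_left d (not_lt.mp hv)
        omega
      interval_cases v <;> omega
    have : u ≠ 0 := by rintro rfl; omega
    have : 2 ≤ u := by omega
    nlinarith
  set σ := iterateFrobenius F p l with hσ
  set τ := iterateFrobenius F p (2 * s - l) with hτ
  set J := iterateFrobenius F p s with hJ
  have H : FrobPair σ τ J := frobPair h2 hF hl hd hd'
  have cδ : (Finset.univ.filter fun x => J x = x ∧ σ x = x).card = p ^ d := by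
    rw [← card_pow_eq_self pp.one_lt hF (by omega : d ≠ 0)
      ((hd ▸ Nat.gcd_dvd_left s l : d ∣ s).mul_left 2)]
    congr 1
    ext x
    simp only [Finset.mem_filter, Finset.mem_univ, true_and, hσ, hJ, iterateFrobenius_def]
    constructor
    · rintro ⟨h3, h4⟩; rw [← hd]; exact pow_gcd_eq_self h3 h4
    · intro h; exact ⟨pow_eq_self_of_dvd (hd ▸ Nat.gcd_dvd_left s l) h,
        pow_eq_self_of_dvd (hd ▸ Nat.gcd_dvd_right s l) h⟩
  have hδ1 : 1 < (Finset.univ.filter fun x => J x = x ∧ σ x = x).card := by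
    rw [cδ]; exact Nat.one_lt_pow (by omega) pp.one_lt
  have cJ : (Finset.univ.filter fun x => J x = x).card = p ^ s :=
    card_pow_eq_self pp.one_lt hF (by omega) (Dvd.intro_left 2 rfl)
  obtain ⟨e, rfl⟩ : ∃ e, s = d + e := ⟨s - d, by omega⟩
  have cim := H.card_exists_mul_sub_eq_one
  rw [cδ, cJ, pow_add] at cim
  have cim' := Nat.eq_of_mul_eq_mul_left (pow_pos pp.pos d) cim
  have ccompl := card_fixed_eq_add σ J
  rw [cJ] at ccompl
  have en2 := H.card_pairs_sq_mul hδ1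
  have en1 := H.card_pairs_self_mul hδ1
  rw [cδ, hF] at en1 en2
  have hsum := sum_of_card_radMap H pp.one_lt (by omega) hF cδ
    (fun a b => (Finset.univ.filter fun w : F × ZMod p =>
      (suppw p (d + e) l a b w.1 w.2).card = p ^ (2 * (d + e) - 1) * (p - 1)).card)
    (perturbCount p (2 * (d + e))) (by simp [perturbCount])
    (fun a b k ha hk => card_codewords_of_pair hp (by omega) h2 hF hl hd hd' ha hk)
  have htotal := card_filter_quadruple (fun a : F => a ^ p ^ (d + e) = a)
    (fun a b c (h : ZMod p) =>
      (suppw p (d + e) l a b c h).card = p ^ (2 * (d + e) - 1) * (p - 1))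
  have hsumQ := congrArg (Int.cast : ℤ → ℚ) hsum
  rw [Int.cast_natCast] at hsumQ
  rw [htotal]
  refine hsumQ.trans ?_
  have hne2 : ¬ Even (2 * (d + e) + d) := by
    rw [Nat.even_add]; simp [hdodd]
  have he1 : Even (2 * (d + e) + 2 * d) := ⟨d + e + d, by ring⟩
  have he2 : Even (2 * (d + e) + 2 * (d + e)) := ⟨2 * (d + e), rfl⟩
  obtain ⟨g, rfl⟩ : ∃ g, d = g + 1 := ⟨d - 1, by omega⟩
  have x1 : 2 * (g + 1 + e) - (g + 1) = g + 1 + 2 * e := by omega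
  have x2 : 2 * (g + 1 + e) - 2 * (g + 1) = 2 * e := by omega
  have x3 : 3 * (g + 1 + e) - (g + 1) = 2 * (g + 1) + 3 * e := by omega
  have x4 : 3 * (g + 1 + e) - 2 * (g + 1) = g + 1 + 3 * e := by omega
  have x5 : g + 1 + 3 * e - 1 = g + 3 * e := by omega
  have x6 : 3 * (g + 1 + e) - 3 * (g + 1) = 3 * e := by omega
  simp only [perturbCount, hne2, he1, he2, if_true, if_false, Nat.sub_self, x1, x2, x3, x4, x5, x6]
  have hpos : ∀ n, 1 ≤ p ^ n := fun n => Nat.one_le_pow _ _ pp.pos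
  have hlt : 1 < p ^ (g + 1) := Nat.one_lt_pow (by omega) pp.one_lt
  have hg : (p : ℚ) ^ (g + 1) ≠ 1 := by exact_mod_cast hlt.ne'
  have en1' := congrArg (Nat.cast : ℕ → ℚ) en1
  have en2' := congrArg (Nat.cast : ℕ → ℚ) en2
  have c2' := congrArg (Nat.cast : ℕ → ℚ) cim'
  have c1' := congrArg (Nat.cast : ℕ → ℚ) ccompl
  rw [Nat.cast_mul, Nat.cast_mul, Nat.cast_sub (hpos _), Nat.cast_sub (hpos _)] at en1'
  rw [Nat.cast_mul, Nat.cast_mul, Nat.cast_sub (Nat.one_le_pow _ _ (hpos _)),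
    Nat.cast_sub (hpos _)] at en2'
  simp only [Nat.cast_add, Nat.cast_pow, Nat.cast_one] at en1' en2' c1' c2'
  rw [← weight_count_identity hg rfl c2' c1' en1' en2']
  push_cast
  ring
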